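/- arXiv:2409.12882 — 4 statements merged into one kernel-verified Lean document; each statement's English description precedes it below -/
import Mathlib

section
/- Let X(1), X(2), …, X(m) be n×n row-stochastic matrices (real matrices with nonnegative entries whose rows each sum to 1). Then δ(X(1)·X(2)·…·X(m)) ≤ ∏_{i=1}^{m} λ(X(i)). -/
/-- `δ(X)`: the largest variation within any column of `X`. -/
noncomputable def delta {n : ℕ} (X : Matrix (Fin n) (Fin n) ℝ) : ℝ :=
  ⨆ j : Fin n, ⨆ i₁ : Fin n, ⨆ i₂ : Fin n, |X i₁ j - X i₂ j|

/-- `λ(X) := 1 - min_{i₁,i₂} Σ_j min(X_{i₁,j}, X_{i₂,j})`. -/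
noncomputable def lam {n : ℕ} (X : Matrix (Fin n) (Fin n) ℝ) : ℝ :=
  1 - ⨅ i₁ : Fin n, ⨅ i₂ : Fin n, ∑ j : Fin n, min (X i₁ j) (X i₂ j)

/-- A matrix is row-stochastic if all entries are nonnegative and each row sums to 1. -/
def IsRowStochastic {n : ℕ} (X : Matrix (Fin n) (Fin n) ℝ) : Prop :=
  (∀ i j, 0 ≤ X i j) ∧ ∀ i, ∑ j, X i j = 1

lemma abs_sub_le_delta {n : ℕ} (X : Matrix (Fin n) (Fin n) ℝ) (i k j : Fin n) :
    |X i j - X k j| ≤ delta X :=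
  le_ciSup_of_le (Set.finite_range _).bddAbove j <|
    le_ciSup_of_le (Set.finite_range _).bddAbove i <|
      le_ciSup_of_le (Set.finite_range _).bddAbove k le_rfl

lemma delta_le {n : ℕ} {X : Matrix (Fin n) (Fin n) ℝ} {c : ℝ} (hc : 0 ≤ c)
    (h : ∀ i k j, |X i j - X k j| ≤ c) : delta X ≤ c :=
  Real.iSup_le (fun j => Real.iSup_le (fun i => Real.iSup_le (fun k => h i k j) hc) hc) hc

lemma delta_nonneg {n : ℕ} (X : Matrix (Fin n) (Fin n) ℝ) : 0 ≤ delta X :=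
  Real.iSup_nonneg fun _ => Real.iSup_nonneg fun _ => Real.iSup_nonneg fun _ => abs_nonneg _

lemma one_sub_sum_min_le_lam {n : ℕ} (X : Matrix (Fin n) (Fin n) ℝ) (i k : Fin n) :
    1 - ∑ j, min (X i j) (X k j) ≤ lam X :=
  sub_le_sub_left (ciInf_le_of_le (Set.finite_range _).bddBelow i <|
    ciInf_le_of_le (Set.finite_range _).bddBelow k le_rfl) 1

lemma lam_nonneg {n : ℕ} {X : Matrix (Fin n) (Fin n) ℝ} (hX : IsRowStochastic X) :
    0 ≤ lam X := by
  rcases isEmpty_or_nonempty (Fin n) with _ | ⟨⟨i⟩⟩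
  · simp [lam, Real.iInf_of_isEmpty]
  · simpa [hX.2 i] using one_sub_sum_min_le_lam X i i

/-- Only the mass which two probability vectors `p` and `q` do not share contributes to the
difference of their averages of `f`. -/
lemma sum_mul_sub_sum_mul_le {ι : Type*} [Fintype ι] {p q f : ι → ℝ} {d : ℝ}
    (hp : ∑ i, p i = 1) (hq : ∑ i, q i = 1) (hf : ∀ i k, f i - f k ≤ d) :
    ∑ i, p i * f i - ∑ i, q i * f i ≤ (1 - ∑ i, min (p i) (q i)) * d := by
  have : Nonempty ι := by
    by_contra h
    rw [not_nonempty_iff] at h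
    simp at hp
  obtain ⟨a, ha⟩ := Finite.exists_max f
  obtain ⟨b, hb⟩ := Finite.exists_min f
  have hs : 0 ≤ 1 - ∑ i, min (p i) (q i) := by
    rw [← hp, ← Finset.sum_sub_distrib]
    exact Finset.sum_nonneg fun i _ => sub_nonneg.2 (min_le_left _ _)
  calc ∑ i, p i * f i - ∑ i, q i * f i
      = ∑ i, (p i - min (p i) (q i)) * f i - ∑ i, (q i - min (p i) (q i)) * f i := by
        rw [← Finset.sum_sub_distrib, ← Finset.sum_sub_distrib]
        exact Finset.sum_congr rfl fun i _ => by ring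
    _ ≤ ∑ i, (p i - min (p i) (q i)) * f a - ∑ i, (q i - min (p i) (q i)) * f b := by
        refine sub_le_sub (Finset.sum_le_sum fun i _ => ?_) (Finset.sum_le_sum fun i _ => ?_)
        · exact mul_le_mul_of_nonneg_left (ha i) (sub_nonneg.2 (min_le_left _ _))
        · exact mul_le_mul_of_nonneg_left (hb i) (sub_nonneg.2 (min_le_right _ _))
    _ = (1 - ∑ i, min (p i) (q i)) * (f a - f b) := by
        rw [← Finset.sum_mul, ← Finset.sum_mul, Finset.sum_sub_distrib, Finset.sum_sub_distrib,
          hp, hq, mul_sub]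
    _ ≤ (1 - ∑ i, min (p i) (q i)) * d := mul_le_mul_of_nonneg_left (hf a b) hs

lemma delta_mul_le {n : ℕ} {X : Matrix (Fin n) (Fin n) ℝ} (hX : IsRowStochastic X)
    (Y : Matrix (Fin n) (Fin n) ℝ) : delta (X * Y) ≤ lam X * delta Y := by
  have key (i k j : Fin n) : (X * Y) i j - (X * Y) k j ≤ lam X * delta Y := by
    rw [Matrix.mul_apply, Matrix.mul_apply]
    exact (sum_mul_sub_sum_mul_le (hX.2 i) (hX.2 k)
      fun a b => (le_abs_self _).trans (abs_sub_le_delta Y a b j)).trans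
      (mul_le_mul_of_nonneg_right (one_sub_sum_min_le_lam X i k) (delta_nonneg Y))
  exact delta_le (mul_nonneg (lam_nonneg hX) (delta_nonneg Y)) fun i k j =>
    abs_sub_le_iff.2 ⟨key i k j, key k i j⟩

lemma delta_one_le {n : ℕ} : delta (1 : Matrix (Fin n) (Fin n) ℝ) ≤ 1 :=
  delta_le zero_le_one fun i k j => by
    rw [Matrix.one_apply, Matrix.one_apply]
    split_ifs <;> simp

theorem stmt0 {n m : ℕ} (X : Fin m → Matrix (Fin n) (Fin n) ℝ)
    (hX : ∀ i, IsRowStochastic (X i)) :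
    delta (List.ofFn X).prod ≤ ∏ i : Fin m, lam (X i) := by
  induction m with
  | zero => simpa using delta_one_le
  | succ m ih =>
    rw [List.ofFn_succ, List.prod_cons, Fin.prod_univ_succ]
    exact (delta_mul_le (hX 0) _).trans
      (mul_le_mul_of_nonneg_left (ih _ fun i => hX i.succ) (lam_nonneg (hX 0)))
end

section
/- Let A(1), …, A(L) be n×n row-stochastic matrices and H(1), …, H(L) be n×n matrices with nonnegative entries, and let β > 0 satisfy β·H(k) ≤ A(k) entrywise for all k. Suppose the product H(1)·…·H(L) has a column j all of whose entries are at least 1. Then λ(A(1)·…·A(L)) ≤ 1 − β^L. -/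
/-- Products of entrywise nonnegative matrices are entrywise nonnegative. -/
theorem prod_ofFn_nonneg {n L : ℕ} {H : Fin L → Matrix (Fin n) (Fin n) ℝ}
    (hH : ∀ k i j, 0 ≤ H k i j) (i j : Fin n) : 0 ≤ (List.ofFn H).prod i j := by
  induction L generalizing i j with
  | zero =>
    rw [List.ofFn_zero, List.prod_nil, Matrix.one_apply]
    split_ifs <;> norm_num
  | succ L ih =>
    rw [List.ofFn_succ, List.prod_cons, Matrix.mul_apply]
    exact Finset.sum_nonneg fun k _ => mul_nonneg (hH 0 i k) (ih (fun k => hH k.succ) k j)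

/-- Entrywise domination `β H(k) ≤ A(k)` of nonnegative matrices passes to products. -/
theorem pow_mul_prod_ofFn_le {n L : ℕ} {A H : Fin L → Matrix (Fin n) (Fin n) ℝ} {β : ℝ}
    (hβ : 0 ≤ β) (hA : ∀ k i j, 0 ≤ A k i j) (hH : ∀ k i j, 0 ≤ H k i j)
    (hdom : ∀ k i j, β * H k i j ≤ A k i j) (i j : Fin n) :
    β ^ L * (List.ofFn H).prod i j ≤ (List.ofFn A).prod i j := by
  induction L generalizing i j with
  | zero => simp
  | succ L ih =>
    simp only [List.ofFn_succ, List.prod_cons, Matrix.mul_apply, Finset.mul_sum]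
    refine Finset.sum_le_sum fun k _ => ?_
    calc β ^ (L + 1) * (H 0 i k * (List.ofFn fun l => H l.succ).prod k j)
        = (β * H 0 i k) * (β ^ L * (List.ofFn fun l => H l.succ).prod k j) := by ring
      _ ≤ A 0 i k * (List.ofFn fun l => A l.succ).prod k j :=
        mul_le_mul (hdom 0 i k)
          (ih (fun l => hA l.succ) (fun l => hH l.succ) (fun l => hdom l.succ) k j)
          (mul_nonneg (pow_nonneg hβ L) (prod_ofFn_nonneg (fun l => hH l.succ) k j))
          (hA 0 i k)

/-- A nonnegative matrix with a column bounded below by `c` has `λ` at most `1 - c`. -/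
theorem lam_le_one_sub {n : ℕ} {X : Matrix (Fin n) (Fin n) ℝ} (hX : ∀ i j, 0 ≤ X i j)
    {c : ℝ} (j : Fin n) (hc : ∀ i, c ≤ X i j) : lam X ≤ 1 - c := by
  have : Nonempty (Fin n) := ⟨j⟩
  refine sub_le_sub_left (le_ciInf fun i₁ => le_ciInf fun i₂ => ?_) 1
  exact (le_min (hc i₁) (hc i₂)).trans <|
    Finset.single_le_sum (f := fun k => min (X i₁ k) (X i₂ k))
      (fun k _ => le_min (hX i₁ k) (hX i₂ k)) (Finset.mem_univ j)

theorem stmt7 {n L : ℕ} (A H : Fin L → Matrix (Fin n) (Fin n) ℝ)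
    (hA : ∀ k, IsRowStochastic (A k)) (hH0 : ∀ k, ∀ i j, 0 ≤ H k i j)
    (β : ℝ) (hβ : 0 < β) (hdom : ∀ k, ∀ i j, β * H k i j ≤ A k i j)
    (j : Fin n) (hcol : ∀ i, 1 ≤ (List.ofFn H).prod i j) :
    lam (List.ofFn A).prod ≤ 1 - β ^ L := by
  have hA0 : ∀ k i j, 0 ≤ A k i j := fun k => (hA k).1
  refine lam_le_one_sub (prod_ofFn_nonneg hA0) j fun i => ?_
  exact (le_mul_of_one_le_right (pow_nonneg hβ.le L) (hcol i)).trans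
    (pow_mul_prod_ofFn_le hβ.le hA0 hH0 hdom i j)
end

section
/- Let 𝓗 be a finite set of τ matrices, each an n×n real matrix with nonnegative entries and with every diagonal entry at least 1, and let N be a positive integer such that for every H ∈ 𝓗 the power H^N has a column all of whose entries are strictly positive. Then for any sequence M(1), …, M(τ·N) of matrices drawn from 𝓗, the product M(1)·M(2)·…·M(τ·N) has a column all of whose entries are strictly positive. -/
theorem list_prod_entry_nonneg {n : ℕ} (l : List (Matrix (Fin n) (Fin n) ℝ))
    (h0 : ∀ A ∈ l, ∀ i j, 0 ≤ A i j) (i j : Fin n) : 0 ≤ l.prod i j := by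
  induction l generalizing i j with
  | nil => rw [List.prod_nil, Matrix.one_apply]; split_ifs <;> simp
  | cons A l ih =>
    rw [List.prod_cons, Matrix.mul_apply]
    exact Finset.sum_nonneg fun k _ => mul_nonneg (h0 A (by simp) i k)
      (ih (fun B hB => h0 B (List.mem_cons_of_mem A hB)) k j)

theorem sublist_prod_entry_le {n : ℕ} {l₁ l₂ : List (Matrix (Fin n) (Fin n) ℝ)}
    (h : l₁.Sublist l₂) (h0 : ∀ A ∈ l₂, ∀ i j, 0 ≤ A i j) (h1 : ∀ A ∈ l₂, ∀ i, 1 ≤ A i i)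
    (i j : Fin n) : l₁.prod i j ≤ l₂.prod i j := by
  induction h generalizing i j with
  | slnil => rfl
  | @cons l₁ l₂ A _ ih =>
    have h0' : ∀ B ∈ l₂, ∀ i j, 0 ≤ B i j := fun B hB => h0 B (List.mem_cons_of_mem A hB)
    have hnn := list_prod_entry_nonneg l₂ h0'
    calc l₁.prod i j ≤ l₂.prod i j := ih h0' (fun B hB => h1 B (List.mem_cons_of_mem A hB)) i j
      _ ≤ A i i * l₂.prod i j := le_mul_of_one_le_left (hnn i j) (h1 A (by simp) i)
      _ ≤ ∑ k, A i k * l₂.prod k j :=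
        Finset.single_le_sum (f := fun k => A i k * l₂.prod k j)
          (fun k _ => mul_nonneg (h0 A (by simp) i k) (hnn k j)) (Finset.mem_univ i)
      _ = (A :: l₂).prod i j := by rw [List.prod_cons, Matrix.mul_apply]
  | @cons_cons l₁ l₂ A _ ih =>
    rw [List.prod_cons, List.prod_cons, Matrix.mul_apply, Matrix.mul_apply]
    exact Finset.sum_le_sum fun k _ => mul_le_mul_of_nonneg_left
      (ih (fun B hB => h0 B (List.mem_cons_of_mem A hB))
        (fun B hB => h1 B (List.mem_cons_of_mem A hB)) k j) (h0 A (by simp) i k)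

theorem stmt8 {n τ N : ℕ} (hτ : 0 < τ) (hN : 0 < N)
    (Hs : Finset (Matrix (Fin n) (Fin n) ℝ)) (hcard : Hs.card = τ)
    (h0 : ∀ H ∈ Hs, ∀ i j, 0 ≤ H i j) (h1 : ∀ H ∈ Hs, ∀ i, 1 ≤ H i i)
    (hpos : ∀ H ∈ Hs, ∃ j, ∀ i, 0 < (H ^ N) i j)
    (M : Fin (τ * N) → Matrix (Fin n) (Fin n) ℝ) (hM : ∀ k, M k ∈ Hs) :
    ∃ j, ∀ i, 0 < (List.ofFn M).prod i j := by
  classical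
  have hmem : ∀ A ∈ List.ofFn M, A ∈ Hs := by
    intro A hA
    obtain ⟨k, rfl⟩ := List.mem_ofFn.mp hA
    exact hM k
  have hsum : ∑ H ∈ Hs, (List.ofFn M).count H = τ * N := by
    simpa using Multiset.sum_count_eq_card (s := Hs) (m := (List.ofFn M : Multiset _)) hmem
  obtain ⟨H, hH, hle⟩ : ∃ H ∈ Hs, N ≤ (List.ofFn M).count H :=
    Finset.exists_le_of_sum_le (Finset.card_pos.mp (hcard ▸ hτ)) (by simp [hsum, hcard])
  obtain ⟨j, hj⟩ := hpos H hH
  refine ⟨j, fun i => (hj i).trans_le ?_⟩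
  rw [← List.prod_replicate]
  exact sublist_prod_entry_le (List.replicate_sublist_iff.mpr hle)
    (fun A hA => h0 A (hmem A hA)) (fun A hA => h1 A (hmem A hA)) i j
end

section
/- Let R > 0 and let Π_R : ℝⁿ → ℝⁿ denote coordinate-wise clipping to the interval [−R, R], i.e., (Π_R(w))_i = max(−R, min(R, w_i)) for each coordinate i. For a vector v ∈ ℝⁿ let v̄ := (1/n)Σ_{i=1}^{n} v_i denote its mean and 𝟏 the all-ones vector. Then for every w ∈ ℝⁿ, ‖Π_R(w) − (mean of Π_R(w))·𝟏‖₂ ≤ ‖w − w̄·𝟏‖₂. -/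
/-- The mean minimizes the sum of squared deviations. -/
theorem sum_sub_mean_sq_le {n : ℕ} (v : Fin n → ℝ) (a : ℝ) :
    ∑ i, (v i - (1 / (n : ℝ)) * ∑ k, v k) ^ 2 ≤ ∑ i, (v i - a) ^ 2 := by
  rcases Nat.eq_zero_or_pos n with rfl | hn
  · simp
  have hn' : (n : ℝ) ≠ 0 := by positivity
  set m := (1 / (n : ℝ)) * ∑ k, v k with hm
  have hdev : ∑ i, (v i - m) = 0 := by
    rw [Finset.sum_sub_distrib, hm]
    simp [hn']
  have hsplit : ∑ i, (v i - a) ^ 2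
      = ∑ i, (v i - m) ^ 2 + 2 * (m - a) * ∑ i, (v i - m) + ∑ _i : Fin n, (m - a) ^ 2 := by
    rw [Finset.mul_sum, ← Finset.sum_add_distrib, ← Finset.sum_add_distrib]
    exact Finset.sum_congr rfl fun i _ => by ring
  have hnonneg : 0 ≤ ∑ _i : Fin n, (m - a) ^ 2 := Finset.sum_nonneg fun _ _ => sq_nonneg _
  rw [hsplit, hdev]
  linarith

/-- Clipping to an interval is 1-Lipschitz. -/
theorem abs_max_min_sub_max_min_le (l u x y : ℝ) :
    |max l (min u x) - max l (min u y)| ≤ |x - y| := by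
  refine (abs_max_sub_max_le_max _ _ _ _).trans ?_
  have h := abs_min_sub_min_le_max u x u y
  simp only [sub_self, abs_zero, abs_nonneg, sup_of_le_right] at h ⊢
  exact h

theorem stmt12 {n : ℕ} (R : ℝ) (hR : 0 < R) (w : Fin n → ℝ) :
    Real.sqrt (∑ i, (max (-R) (min R (w i))
        - (1 / (n : ℝ)) * ∑ k, max (-R) (min R (w k))) ^ 2)
      ≤ Real.sqrt (∑ i, (w i - (1 / (n : ℝ)) * ∑ k, w k) ^ 2) := by
  refine Real.sqrt_le_sqrt ((sum_sub_mean_sq_le (fun i => max (-R) (min R (w i)))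
    (max (-R) (min R ((1 / (n : ℝ)) * ∑ k, w k)))).trans ?_)
  exact Finset.sum_le_sum fun i _ => sq_le_sq.mpr (abs_max_min_sub_max_min_le _ _ _ _)
end
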